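/- arXiv:2309.07830 — 2 statements merged into one kernel-verified Lean document; each statement's English description precedes it below -/
import Mathlib

section
/- For any three pairwise orthogonal unit vectors u, v, w ∈ ℝ⁸ the triple product u×v×w is a unit vector: Σ_{i=1}^{8} Φ₀(u,v,w,eᵢ)² = 1. Consequently Φ₀(u,v,w,u×v×w) = 1, so that span{u,v,w,u×v×w} is a Cayley plane containing u, v, w. -/
open scoped BigOperators RealInnerProductSpace

noncomputable section

/-- ℝ⁸ with its Euclidean inner product. -/
abbrev V8 : Type := EuclideanSpace ℝ (Fin 8)

/-- The standard orthonormal basis vectors e₁, …, e₈ of ℝ⁸ (indexed by `Fin 8`). -/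
def e (i : Fin 8) : V8 := EuclideanSpace.single i (1 : ℝ)

/-- The alternating 4-form `dxᵢ ∧ dxⱼ ∧ dx_k ∧ dx_l` on ℝ⁸. -/
def dxQ (i j k l : Fin 8) : AlternatingMap ℝ V8 ℝ (Fin 4) :=
  (Matrix.detRowAlternating : AlternatingMap ℝ (Fin 4 → ℝ) ℝ (Fin 4)).compLinearMap
    (LinearMap.pi fun a : Fin 4 =>
      ((EuclideanSpace.proj (![i, j, k, l] a) : V8 →L[ℝ] ℝ) : V8 →ₗ[ℝ] ℝ))

/-- The standard Cayley form Φ₀ on ℝ⁸. -/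
def Phi0 : AlternatingMap ℝ V8 ℝ (Fin 4) :=
  dxQ 0 1 2 3 - dxQ 0 1 4 5 - dxQ 0 1 6 7 - dxQ 0 2 4 6 + dxQ 0 2 5 7 -
    dxQ 0 3 4 7 - dxQ 0 3 5 6 - dxQ 1 2 4 7 - dxQ 1 2 5 6 + dxQ 1 3 4 6 -
    dxQ 1 3 5 7 - dxQ 2 3 4 5 - dxQ 2 3 6 7 + dxQ 4 5 6 7

/-- The triple product `u×v×w = (ι(u)ι(v)ι(w)Φ₀)^♯`, i.e. the unique vector with
`⟨u×v×w, x⟩ = Φ₀(u,v,w,x)` for all `x`. -/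
def tripleProd (u v w : V8) : V8 :=
  ∑ i : Fin 8, Phi0 ![u, v, w, e i] • e i

/-- The `3 × 3` minor of the rows `u, v, w` in the columns `a, b, c`. -/
def minor (u v w : V8) (a b c : Fin 8) : ℝ :=
  u a * (v b * w c - v c * w b) - u b * (v a * w c - v c * w a) +
    u c * (v a * w b - v b * w a)

theorem dxQ_apply (u v w x : V8) (i j k l : Fin 8) :
    dxQ i j k l ![u, v, w, x] =
      minor u v w i j k * x l - minor u v w i j l * x k + minor u v w i k l * x j -
        minor u v w j k l * x i := by
  have hdet : dxQ i j k l ![u, v, w, x] =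
      Matrix.det !![u i, u j, u k, u l; v i, v j, v k, v l; w i, w j, w k, w l;
        x i, x j, x k, x l] := by
    change Matrix.det (n := Fin 4) (R := ℝ) _ = Matrix.det _
    congr 1
    ext a b
    fin_cases a <;> fin_cases b <;> rfl
  rw [hdet, Matrix.det_succ_row_zero]
  simp [Fin.sum_univ_succ, Matrix.det_fin_three, Fin.succAbove, minor]
  ring

set_option maxHeartbeats 4000000 in
/-- The squared norm of the triple product is the Gram determinant of its arguments. -/
theorem sum_Phi0_sq (u v w : V8) :
    ∑ i, (Phi0 ![u, v, w, e i]) ^ 2 =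
      inner ℝ u u * inner ℝ v v * inner ℝ w w + 2 * inner ℝ u v * inner ℝ v w * inner ℝ u w -
        inner ℝ u u * inner ℝ v w ^ 2 - inner ℝ v v * inner ℝ u w ^ 2 -
        inner ℝ w w * inner ℝ u v ^ 2 := by
  simp only [Phi0, AlternatingMap.add_apply, AlternatingMap.sub_apply, dxQ_apply, e,
    Fin.sum_univ_eight, PiLp.inner_apply, PiLp.single_apply, RCLike.inner_apply,
    conj_trivial]
  simp only [Fin.reduceEq, if_true, if_false, mul_one, mul_zero, zero_sub, sub_zero, zero_add,
    add_zero]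
  simp only [minor]
  ring

theorem Phi0_tripleProd (u v w : V8) :
    Phi0 ![u, v, w, tripleProd u v w] = ∑ i, (Phi0 ![u, v, w, e i]) ^ 2 := by
  have hlast (x : V8) : ![u, v, w, x] = Function.update ![u, v, w, 0] 3 x := by
    ext a : 1
    fin_cases a <;> rfl
  rw [hlast, tripleProd, AlternatingMap.map_update_sum]
  refine Finset.sum_congr rfl fun i _ => ?_
  rw [AlternatingMap.map_update_smul, ← hlast, smul_eq_mul, sq]

/-- **The triple product of an orthonormal triple is a unit vector:** for pairwise orthogonal
unit vectors `u, v, w` one has `Σᵢ Φ₀(u,v,w,eᵢ)² = 1`, and consequently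
`Φ₀(u, v, w, u×v×w) = 1`, so `span{u,v,w,u×v×w}` is a Cayley plane containing `u, v, w`. -/
theorem tripleProd_unit (u v w : V8) (h : Orthonormal ℝ ![u, v, w]) :
    (∑ i : Fin 8, (Phi0 ![u, v, w, e i]) ^ 2 = 1) ∧
      Phi0 ![u, v, w, tripleProd u v w] = 1 := by
  have hsum : ∑ i : Fin 8, (Phi0 ![u, v, w, e i]) ^ 2 = 1 := by
    have huv : inner ℝ u v = 0 := h.2 (show (0 : Fin 3) ≠ 1 by decide)
    have huw : inner ℝ u w = 0 := h.2 (show (0 : Fin 3) ≠ 2 by decide)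
    have hvw : inner ℝ v w = 0 := h.2 (show (1 : Fin 3) ≠ 2 by decide)
    have hu : ‖u‖ = 1 := h.1 0
    have hv : ‖v‖ = 1 := h.1 1
    have hw : ‖w‖ = 1 := h.1 2
    simp [sum_Phi0_sq, huv, huw, hvw, hu, hv, hw]
  exact ⟨hsum, (Phi0_tripleProd u v w).trans hsum⟩
end
end

section
/- Let ξ = span{e₁,e₂,e₃,e₄} ⊂ ℝ⁸ (a Cayley plane for Φ₀) and let Λ²₇ = {ω alternating 2-form on ℝ⁸ : Tω = 3ω} be the 7-dimensional eigenspace of T. Consider the linear restriction map ρ : Λ²₇ → {alternating 2-forms on ξ}, ρ(ω) = ω|_{ξ×ξ}. Then the kernel E_ξ = {ω ∈ Λ²₇ : ω|_ξ = 0} of ρ has dimension 4, and the range of ρ has dimension 3. Hence Λ²₇ splits as the direct sum of the rank-4 subspace E_ξ and a rank-3 complement Λ²₋ξ. -/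
open scoped BigOperators RealInnerProductSpace

noncomputable section

/-- Evaluation of an alternating 2-form at a fixed pair of vectors, as a linear functional. -/
def evalSM (v : Fin 2 → V8) : AlternatingMap ℝ V8 ℝ (Fin 2) →ₗ[ℝ] ℝ where
  toFun ω := ω v
  map_add' _ _ := rfl
  map_smul' _ _ := rfl

/-- The alternating 2-form `(x, y) ↦ Φ₀(u, v, x, y)`. -/
def iotaPhi (u v : V8) : AlternatingMap ℝ V8 ℝ (Fin 2) :=
  (Phi0.curryLeft u).curryLeft v

/-- The operator `T : ω ↦ ⋆(Φ₀ ∧ ω)` on alternating 2-forms. -/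
def T : AlternatingMap ℝ V8 ℝ (Fin 2) →ₗ[ℝ] AlternatingMap ℝ V8 ℝ (Fin 2) :=
  ∑ i : Fin 8, ∑ j : Fin 8,
    if i < j then (evalSM ![e i, e j]).smulRight (iotaPhi (e i) (e j)) else 0

/-- The 3-eigenspace Λ²₇ of T. -/
def Lambda7 : Submodule ℝ (AlternatingMap ℝ V8 ℝ (Fin 2)) :=
  LinearMap.ker (T - (3 : ℝ) • LinearMap.id)

/-- The Cayley plane ξ = span{e₁,e₂,e₃,e₄}. -/
def xi : Submodule ℝ V8 := Submodule.span ℝ {e 0, e 1, e 2, e 3}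

/-- Restriction of alternating 2-forms on ℝ⁸ to the subspace ξ, as a linear map. -/
def restr : AlternatingMap ℝ V8 ℝ (Fin 2) →ₗ[ℝ] AlternatingMap ℝ xi ℝ (Fin 2) where
  toFun ω := ω.compLinearMap xi.subtype
  map_add' _ _ := rfl
  map_smul' _ _ := rfl

/-- The restriction map ρ : Λ²₇ → {alternating 2-forms on ξ}. -/
def rho : Lambda7 →ₗ[ℝ] AlternatingMap ℝ xi ℝ (Fin 2) :=
  restr.comp Lambda7.subtype

/-- The alternating 2-form `dxᵢ ∧ dxⱼ` on ℝ⁸. -/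
def dxD (i j : Fin 8) : AlternatingMap ℝ V8 ℝ (Fin 2) :=
  (Matrix.detRowAlternating : AlternatingMap ℝ (Fin 2 → ℝ) ℝ (Fin 2)).compLinearMap
    (LinearMap.pi fun a : Fin 2 =>
      ((EuclideanSpace.proj (![i, j] a) : V8 →L[ℝ] ℝ) : V8 →ₗ[ℝ] ℝ))

lemma e_apply (i j : Fin 8) : e i j = if j = i then 1 else 0 := by
  simp [e]

lemma dxD_apply (i j : Fin 8) (x y : V8) : dxD i j ![x, y] = x i * y j - x j * y i :=
  Matrix.det_fin_two (Matrix.of fun a b : Fin 2 => (![x, y] a).ofLp (![i, j] b))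

/-- Laplace expansion of a determinant of order 4 along its first two rows. -/
lemma det_of_vec_four {R : Type*} [CommRing R] (u v x y : Fin 4 → R) :
    Matrix.det (Matrix.of ![u, v, x, y]) =
      (u 0 * v 1 - u 1 * v 0) * (x 2 * y 3 - x 3 * y 2) -
      (u 0 * v 2 - u 2 * v 0) * (x 1 * y 3 - x 3 * y 1) +
      (u 0 * v 3 - u 3 * v 0) * (x 1 * y 2 - x 2 * y 1) +
      (u 1 * v 2 - u 2 * v 1) * (x 0 * y 3 - x 3 * y 0) -
      (u 1 * v 3 - u 3 * v 1) * (x 0 * y 2 - x 2 * y 0) +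
      (u 2 * v 3 - u 3 * v 2) * (x 0 * y 1 - x 1 * y 0) := by
  rw [Matrix.det_succ_row_zero]
  simp only [Matrix.det_fin_three, Fin.sum_univ_four, Matrix.submatrix_apply]
  simp [Fin.succAbove, Fin.lt_def]
  ring

lemma dxQ_apply_eq_det (a b c d : Fin 8) (m : Fin 4 → V8) :
    dxQ a b c d m = Matrix.det (Matrix.of fun r s => m r (![a, b, c, d] s)) := rfl

lemma dxQ_apply_s5 (a b c d : Fin 8) (u v x y : V8) :
    dxQ a b c d ![u, v, x, y] =
      dxD a b ![u, v] * dxD c d ![x, y] - dxD a c ![u, v] * dxD b d ![x, y] +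
      dxD a d ![u, v] * dxD b c ![x, y] + dxD b c ![u, v] * dxD a d ![x, y] -
      dxD b d ![u, v] * dxD a c ![x, y] + dxD c d ![u, v] * dxD a b ![x, y] := by
  have h : (fun r s => ![u, v, x, y] r (![a, b, c, d] s)) =
      ![fun s => u (![a, b, c, d] s), fun s => v (![a, b, c, d] s),
        fun s => x (![a, b, c, d] s), fun s => y (![a, b, c, d] s)] := by
    funext r
    fin_cases r <;> rfl
  rw [dxQ_apply_eq_det, h, det_of_vec_four]
  simp only [dxD_apply]
  rfl

/-- The pairing `Ψ ↦ ∑_{i<j} ω(eᵢ,eⱼ) Ψ(eᵢ,eⱼ,x,y)` on alternating 4-forms. -/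
def contraction (ω : AlternatingMap ℝ V8 ℝ (Fin 2)) (x y : V8) :
    AlternatingMap ℝ V8 ℝ (Fin 4) →ₗ[ℝ] ℝ where
  toFun Ψ := ∑ i, ∑ j, if i < j then ω ![e i, e j] * Ψ ![e i, e j, x, y] else 0
  map_add' Ψ Ψ' := by
    simp only [← Finset.sum_add_distrib]
    refine Finset.sum_congr rfl fun i _ => Finset.sum_congr rfl fun j _ => ?_
    split_ifs <;> simp [mul_add]
  map_smul' c Ψ := by
    simp [Finset.mul_sum, mul_left_comm]

lemma sum_lt_mul_dxD (f : Fin 8 → Fin 8 → ℝ) {a b : Fin 8} (h : a < b) :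
    (∑ i, ∑ j, if i < j then f i j * dxD a b ![e i, e j] else 0) = f a b := by
  rw [Finset.sum_eq_single_of_mem a (Finset.mem_univ a),
    Finset.sum_eq_single_of_mem b (Finset.mem_univ b)]
  · simp [dxD_apply, e_apply, h, h.ne, h.ne']
  · intro j _ hj
    simp [dxD_apply, e_apply, hj.symm, h.ne']
  · intro i _ hi
    refine Finset.sum_eq_zero fun j _ => ?_
    simp only [dxD_apply, e_apply]
    grind

lemma contraction_dxQ (ω : AlternatingMap ℝ V8 ℝ (Fin 2)) {a b c d : Fin 8} (hab : a < b)
    (hbc : b < c) (hcd : c < d) (x y : V8) :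
    contraction ω x y (dxQ a b c d) =
      ω ![e a, e b] * dxD c d ![x, y] - ω ![e a, e c] * dxD b d ![x, y] +
      ω ![e a, e d] * dxD b c ![x, y] + ω ![e b, e c] * dxD a d ![x, y] -
      ω ![e b, e d] * dxD a c ![x, y] + ω ![e c, e d] * dxD a b ![x, y] := by
  have hs {p q : Fin 8} (h : p < q) := sum_lt_mul_dxD (fun i j => ω ![e i, e j]) h
  rw [← hs hab, ← hs (hab.trans hbc), ← hs (hab.trans (hbc.trans hcd)), ← hs hbc,
    ← hs (hbc.trans hcd), ← hs hcd]
  simp only [contraction, LinearMap.coe_mk, AddHom.coe_mk, Finset.sum_mul,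
    ← Finset.sum_add_distrib, ← Finset.sum_sub_distrib]
  refine Finset.sum_congr rfl fun i _ => Finset.sum_congr rfl fun j _ => ?_
  split_ifs
  · rw [dxQ_apply_s5]; ring
  · ring

lemma T_apply_eq_contraction (ω : AlternatingMap ℝ V8 ℝ (Fin 2)) (x y : V8) :
    T ω ![x, y] = contraction ω x y Phi0 := by
  change evalSM ![x, y] (T ω) = _
  simp only [T, LinearMap.sum_apply, map_sum]
  change _ = ∑ i, ∑ j, if i < j then ω ![e i, e j] * Phi0 ![e i, e j, x, y] else 0
  refine Finset.sum_congr rfl fun i _ => Finset.sum_congr rfl fun j _ => ?_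
  split_ifs
  · simp [evalSM, iotaPhi]
  · simp

/-- The operator `T` in coordinates. -/
lemma T_apply (ω : AlternatingMap ℝ V8 ℝ (Fin 2)) (x y : V8) :
    T ω ![x, y] =
      (ω ![e 2, e 3] - ω ![e 4, e 5] - ω ![e 6, e 7]) * dxD 0 1 ![x, y] +
      (-ω ![e 1, e 3] - ω ![e 4, e 6] + ω ![e 5, e 7]) * dxD 0 2 ![x, y] +
      (ω ![e 1, e 2] - ω ![e 4, e 7] - ω ![e 5, e 6]) * dxD 0 3 ![x, y] +
      (ω ![e 1, e 5] + ω ![e 2, e 6] + ω ![e 3, e 7]) * dxD 0 4 ![x, y] +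
      (-ω ![e 1, e 4] - ω ![e 2, e 7] + ω ![e 3, e 6]) * dxD 0 5 ![x, y] +
      (ω ![e 1, e 7] - ω ![e 2, e 4] - ω ![e 3, e 5]) * dxD 0 6 ![x, y] +
      (-ω ![e 1, e 6] + ω ![e 2, e 5] - ω ![e 3, e 4]) * dxD 0 7 ![x, y] +
      (ω ![e 0, e 3] - ω ![e 4, e 7] - ω ![e 5, e 6]) * dxD 1 2 ![x, y] +
      (-ω ![e 0, e 2] + ω ![e 4, e 6] - ω ![e 5, e 7]) * dxD 1 3 ![x, y] +
      (-ω ![e 0, e 5] + ω ![e 2, e 7] - ω ![e 3, e 6]) * dxD 1 4 ![x, y] +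
      (ω ![e 0, e 4] + ω ![e 2, e 6] + ω ![e 3, e 7]) * dxD 1 5 ![x, y] +
      (-ω ![e 0, e 7] - ω ![e 2, e 5] + ω ![e 3, e 4]) * dxD 1 6 ![x, y] +
      (ω ![e 0, e 6] - ω ![e 2, e 4] - ω ![e 3, e 5]) * dxD 1 7 ![x, y] +
      (ω ![e 0, e 1] - ω ![e 4, e 5] - ω ![e 6, e 7]) * dxD 2 3 ![x, y] +
      (-ω ![e 0, e 6] - ω ![e 1, e 7] + ω ![e 3, e 5]) * dxD 2 4 ![x, y] +
      (ω ![e 0, e 7] - ω ![e 1, e 6] - ω ![e 3, e 4]) * dxD 2 5 ![x, y] +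
      (ω ![e 0, e 4] + ω ![e 1, e 5] + ω ![e 3, e 7]) * dxD 2 6 ![x, y] +
      (-ω ![e 0, e 5] + ω ![e 1, e 4] - ω ![e 3, e 6]) * dxD 2 7 ![x, y] +
      (-ω ![e 0, e 7] + ω ![e 1, e 6] - ω ![e 2, e 5]) * dxD 3 4 ![x, y] +
      (-ω ![e 0, e 6] - ω ![e 1, e 7] + ω ![e 2, e 4]) * dxD 3 5 ![x, y] +
      (ω ![e 0, e 5] - ω ![e 1, e 4] - ω ![e 2, e 7]) * dxD 3 6 ![x, y] +
      (ω ![e 0, e 4] + ω ![e 1, e 5] + ω ![e 2, e 6]) * dxD 3 7 ![x, y] +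
      (-ω ![e 0, e 1] - ω ![e 2, e 3] + ω ![e 6, e 7]) * dxD 4 5 ![x, y] +
      (-ω ![e 0, e 2] + ω ![e 1, e 3] - ω ![e 5, e 7]) * dxD 4 6 ![x, y] +
      (-ω ![e 0, e 3] - ω ![e 1, e 2] + ω ![e 5, e 6]) * dxD 4 7 ![x, y] +
      (-ω ![e 0, e 3] - ω ![e 1, e 2] + ω ![e 4, e 7]) * dxD 5 6 ![x, y] +
      (ω ![e 0, e 2] - ω ![e 1, e 3] - ω ![e 4, e 6]) * dxD 5 7 ![x, y] +
      (-ω ![e 0, e 1] - ω ![e 2, e 3] + ω ![e 4, e 5]) * dxD 6 7 ![x, y] := by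
  rw [T_apply_eq_contraction]
  simp (discharger := decide) only [Phi0, map_add, map_sub, contraction_dxQ]
  ring

lemma ext_of_lt {η ω : AlternatingMap ℝ V8 ℝ (Fin 2)}
    (h : ∀ i j : Fin 8, i < j → η ![e i, e j] = ω ![e i, e j]) : η = ω := by
  refine (EuclideanSpace.basisFun (Fin 8) ℝ).toBasis.ext_alternating fun v hv => ?_
  have hve : (fun k => (EuclideanSpace.basisFun (Fin 8) ℝ).toBasis (v k)) =
      ![e (v 0), e (v 1)] := by
    ext k : 1
    fin_cases k <;> simp [e]
  rw [hve]
  rcases lt_trichotomy (v 0) (v 1) with hlt | heq | hgt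
  · exact h _ _ hlt
  · exact absurd (hv heq) (by decide)
  · have hswap (α : AlternatingMap ℝ V8 ℝ (Fin 2)) (x y : V8) : α ![x, y] = -α ![y, x] := by
      rw [← α.map_swap ![y, x] (i := 0) (j := 1) (by decide)]
      congr 1
      ext k : 1
      fin_cases k <;> rfl
    rw [hswap η, hswap ω, h _ _ hgt]

/-- The elements of `Lambda7` restricting to the standard self-dual forms on the plane `xi`. -/
def tangentialForm : Fin 3 → AlternatingMap ℝ V8 ℝ (Fin 2) :=
  ![dxD 0 1 + dxD 2 3 - dxD 4 5 - dxD 6 7,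
    dxD 0 2 - dxD 1 3 - dxD 4 6 + dxD 5 7,
    dxD 0 3 + dxD 1 2 - dxD 4 7 - dxD 5 6]

/-- A spanning family of the elements of `Lambda7` vanishing on the plane `xi`. -/
def mixedForm : Fin 4 → AlternatingMap ℝ V8 ℝ (Fin 2) :=
  ![dxD 0 4 + dxD 1 5 + dxD 2 6 + dxD 3 7,
    dxD 0 5 - dxD 1 4 - dxD 2 7 + dxD 3 6,
    dxD 0 6 + dxD 1 7 - dxD 2 4 - dxD 3 5,
    dxD 0 7 - dxD 1 6 + dxD 2 5 - dxD 3 4]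

lemma mem_Lambda7_iff {ω : AlternatingMap ℝ V8 ℝ (Fin 2)} : ω ∈ Lambda7 ↔ T ω = (3 : ℝ) • ω := by
  simp [Lambda7, sub_eq_zero]

lemma tangentialForm_mem (k : Fin 3) : tangentialForm k ∈ Lambda7 := by
  rw [mem_Lambda7_iff]
  refine ext_of_lt fun i j _ => ?_
  rw [T_apply]
  fin_cases k <;> simp [tangentialForm, dxD_apply, e_apply] <;> ring

lemma mixedForm_mem (k : Fin 4) : mixedForm k ∈ Lambda7 := by
  rw [mem_Lambda7_iff]
  refine ext_of_lt fun i j _ => ?_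
  rw [T_apply]
  fin_cases k <;> simp [mixedForm, dxD_apply, e_apply] <;> ring

set_option maxHeartbeats 1000000 in
lemma eq_sum_of_mem_Lambda7 {ω : AlternatingMap ℝ V8 ℝ (Fin 2)} (hω : ω ∈ Lambda7) :
    ω = ∑ k : Fin 3, ω ![e 0, e (![1, 2, 3] k)] • tangentialForm k +
      ∑ k : Fin 4, ω ![e 0, e (![4, 5, 6, 7] k)] • mixedForm k := by
  rw [mem_Lambda7_iff] at hω
  have h (i j : Fin 8) : T ω ![e i, e j] = 3 * ω ![e i, e j] := by
    rw [hω]; rfl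
  simp only [T_apply] at h
  have h1 : ω ![e 2, e 3] = ω ![e 0, e 1] ∧
      ω ![e 4, e 5] = -ω ![e 0, e 1] ∧ ω ![e 6, e 7] = -ω ![e 0, e 1] := by
    have r1 := h 0 1
    have r2 := h 2 3
    have r3 := h 4 5
    have r4 := h 6 7
    simp [dxD_apply, e_apply] at r1 r2 r3 r4
    refine ⟨?_, ?_, ?_⟩ <;> linarith
  have h2 : ω ![e 1, e 3] = -ω ![e 0, e 2] ∧
      ω ![e 4, e 6] = -ω ![e 0, e 2] ∧ ω ![e 5, e 7] = ω ![e 0, e 2] := by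
    have r1 := h 0 2
    have r2 := h 1 3
    have r3 := h 4 6
    have r4 := h 5 7
    simp [dxD_apply, e_apply] at r1 r2 r3 r4
    refine ⟨?_, ?_, ?_⟩ <;> linarith
  have h3 : ω ![e 1, e 2] = ω ![e 0, e 3] ∧
      ω ![e 4, e 7] = -ω ![e 0, e 3] ∧ ω ![e 5, e 6] = -ω ![e 0, e 3] := by
    have r1 := h 0 3
    have r2 := h 1 2
    have r3 := h 4 7
    have r4 := h 5 6
    simp [dxD_apply, e_apply] at r1 r2 r3 r4
    refine ⟨?_, ?_, ?_⟩ <;> linarith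
  have h4 : ω ![e 1, e 5] = ω ![e 0, e 4] ∧
      ω ![e 2, e 6] = ω ![e 0, e 4] ∧ ω ![e 3, e 7] = ω ![e 0, e 4] := by
    have r1 := h 0 4
    have r2 := h 1 5
    have r3 := h 2 6
    have r4 := h 3 7
    simp [dxD_apply, e_apply] at r1 r2 r3 r4
    refine ⟨?_, ?_, ?_⟩ <;> linarith
  have h5 : ω ![e 1, e 4] = -ω ![e 0, e 5] ∧
      ω ![e 2, e 7] = -ω ![e 0, e 5] ∧ ω ![e 3, e 6] = ω ![e 0, e 5] := by
    have r1 := h 0 5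
    have r2 := h 1 4
    have r3 := h 2 7
    have r4 := h 3 6
    simp [dxD_apply, e_apply] at r1 r2 r3 r4
    refine ⟨?_, ?_, ?_⟩ <;> linarith
  have h6 : ω ![e 1, e 7] = ω ![e 0, e 6] ∧
      ω ![e 2, e 4] = -ω ![e 0, e 6] ∧ ω ![e 3, e 5] = -ω ![e 0, e 6] := by
    have r1 := h 0 6
    have r2 := h 1 7
    have r3 := h 2 4
    have r4 := h 3 5
    simp [dxD_apply, e_apply] at r1 r2 r3 r4
    refine ⟨?_, ?_, ?_⟩ <;> linarith
  have h7 : ω ![e 1, e 6] = -ω ![e 0, e 7] ∧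
      ω ![e 2, e 5] = ω ![e 0, e 7] ∧ ω ![e 3, e 4] = -ω ![e 0, e 7] := by
    have r1 := h 0 7
    have r2 := h 1 6
    have r3 := h 2 5
    have r4 := h 3 4
    simp [dxD_apply, e_apply] at r1 r2 r3 r4
    refine ⟨?_, ?_, ?_⟩ <;> linarith
  refine ext_of_lt fun i j hij => ?_
  fin_cases i <;> fin_cases j <;> first
    | exact absurd hij (by decide)
    | simp [Fin.sum_univ_succ, tangentialForm, mixedForm, dxD_apply, e_apply,
        h1, h2, h3, h4, h5, h6, h7]

lemma linearIndependent_sumElim :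
    LinearIndependent ℝ (Sum.elim tangentialForm mixedForm) := by
  rw [Fintype.linearIndependent_iff]
  intro g hg
  have h (j : Fin 8) := congrArg (fun ω => ω ![e 0, e j]) hg
  simp [Fin.sum_univ_succ, tangentialForm, mixedForm, dxD_apply, e_apply] at h
  rintro (k | k) <;> fin_cases k
  · simpa using h 1
  · simpa using h 2
  · simpa using h 3
  · simpa using h 4
  · simpa using h 5
  · simpa using h 6
  · simpa using h 7

lemma Lambda7_eq_span :
    Lambda7 = Submodule.span ℝ (Set.range (Sum.elim tangentialForm mixedForm)) := by
  refine le_antisymm (fun ω hω => ?_) (Submodule.span_le.2 ?_)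
  · rw [eq_sum_of_mem_Lambda7 hω]
    refine add_mem (sum_mem fun k _ => Submodule.smul_mem _ _ ?_)
      (sum_mem fun k _ => Submodule.smul_mem _ _ ?_)
    · exact Submodule.subset_span ⟨Sum.inl k, rfl⟩
    · exact Submodule.subset_span ⟨Sum.inr k, rfl⟩
  · rintro _ ⟨k | k, rfl⟩
    exacts [tangentialForm_mem k, mixedForm_mem k]

lemma finrank_Lambda7 : Module.finrank ℝ Lambda7 = 7 := by
  rw [Lambda7_eq_span, finrank_span_eq_card linearIndependent_sumElim]
  rfl

lemma restr_mixedForm (k : Fin 4) : restr (mixedForm k) = 0 := by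
  have hxi (z : xi) (l : Fin 8) (hl : 4 ≤ l) : (z : V8) l = 0 := by
    have hle : xi ≤ LinearMap.ker ((EuclideanSpace.proj l : V8 →L[ℝ] ℝ) : V8 →ₗ[ℝ] ℝ) := by
      refine Submodule.span_le.2 ?_
      rintro _ (rfl | rfl | rfl | rfl) <;> simp [e] <;> rintro rfl <;> revert hl <;> decide
    exact hle z.2
  ext v
  have hv : restr (mixedForm k) v = mixedForm k ![(v 0 : V8), (v 1 : V8)] := by
    change mixedForm k _ = _
    congr 1
    ext l : 1
    fin_cases l <;> rfl
  rw [hv]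
  have hxi' (z : xi) := And.intro (hxi z 4 (by decide)) <| And.intro (hxi z 5 (by decide)) <|
    And.intro (hxi z 6 (by decide)) (hxi z 7 (by decide))
  fin_cases k <;> simp [mixedForm, dxD_apply, hxi']

lemma linearIndependent_restr_tangentialForm :
    LinearIndependent ℝ (restr ∘ tangentialForm) := by
  rw [Fintype.linearIndependent_iff]
  intro g hg
  have h (j : Fin 8) (hj : e j ∈ xi) :
      ∑ k, g k * tangentialForm k ![e 0, e j] = 0 := by
    have h0 : e 0 ∈ xi := Submodule.subset_span (by simp)
    have := congrArg (fun ω => ω ![⟨e 0, h0⟩, ⟨e j, hj⟩]) hg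
    have hr (k : Fin 3) : restr (tangentialForm k) ![⟨e 0, h0⟩, ⟨e j, hj⟩] =
        tangentialForm k ![e 0, e j] := by
      change tangentialForm k _ = _
      congr 1
      ext l : 1
      fin_cases l <;> rfl
    simpa [hr, Fin.sum_univ_three] using this
  have h1 := h 1 (Submodule.subset_span (by simp))
  have h2 := h 2 (Submodule.subset_span (by simp))
  have h3 := h 3 (Submodule.subset_span (by simp))
  simp [Fin.sum_univ_three, tangentialForm, dxD_apply, e_apply] at h1 h2 h3
  intro k
  fin_cases k <;> assumption

lemma range_rho : LinearMap.range rho = Submodule.span ℝ (Set.range (restr ∘ tangentialForm)) := by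
  have hzero : restr '' Set.range mixedForm ⊆ {0} := by
    rintro _ ⟨_, ⟨k, rfl⟩, rfl⟩
    exact restr_mixedForm k
  rw [rho, LinearMap.range_comp, Submodule.range_subtype, Lambda7_eq_span, Submodule.map_span,
    Set.Sum.elim_range, Set.image_union, Submodule.span_union,
    Submodule.span_eq_bot.2 hzero, sup_bot_eq, Set.range_comp]

/-- **The splitting Λ²₇ = E_ξ ⊕ Λ²₋ξ:** the kernel `E_ξ = {ω ∈ Λ²₇ : ω|_ξ = 0}` of the
restriction map `ρ` has dimension 4, and its range has dimension 3. -/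
theorem lambda7_splitting :
    Module.finrank ℝ (LinearMap.ker rho) = 4 ∧
      Module.finrank ℝ (LinearMap.range rho) = 3 := by
  have hr : Module.finrank ℝ (LinearMap.range rho) = 3 := by
    rw [range_rho, finrank_span_eq_card linearIndependent_restr_tangentialForm]
    rfl
  have : FiniteDimensional ℝ Lambda7 :=
    FiniteDimensional.of_finrank_pos (by rw [finrank_Lambda7]; norm_num)
  have hk := LinearMap.finrank_range_add_finrank_ker (K := ℝ) (V := Lambda7)
    (V₂ := AlternatingMap ℝ xi ℝ (Fin 2)) rho
  rw [hr, finrank_Lambda7] at hk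
  exact ⟨by omega, hr⟩
end
end
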